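/- Let X and Y be Polish spaces, t ≥ 1, μ ∈ P_t(X), ν ∈ P_t(Y), and let C : X × P_t(Y) → ℝ be continuous and satisfy |C(x,p)| ≤ R ( d_X(x,x₀)^t + ∫_Y d_Y(y,y₀)^t p(dy) ) for some constant R and base points x₀ ∈ X, y₀ ∈ Y, with p ↦ C(x,p) convex for every x. Then every C-monotone coupling π ∈ Π(μ,ν) is optimal for the weak transport problem V_C(μ,ν) = inf_{π' ∈ Π(μ,ν)} ∫_X C(x,π'_x) μ(dx). -/

import Mathlib

open MeasureTheory ProbabilityTheory ENNReal NNReal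

noncomputable section

/-- A probability measure has finite `t`-th moment. -/
def MemPt {Z : Type*} [MetricSpace Z] [MeasurableSpace Z] (t : ℝ)
    (p : ProbabilityMeasure Z) : Prop :=
  ∃ z₀ : Z, Integrable (fun z => dist z z₀ ^ t) (p : Measure Z)

/-- The class `Φ_t` of continuous functions with growth of order at most `t`. -/
def PhiT (t : ℝ) (Y : Type*) [MetricSpace Y] : Set (Y → ℝ) :=
  {g | Continuous g ∧ ∃ (K : ℝ) (y₀ : Y), ∀ y, |g y| ≤ K * (1 + dist y y₀ ^ t)}

/-- The space `𝒫_t(Y)` of probability measures with finite `t`-th moment. -/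
def PtSpace (t : ℝ) (Y : Type*) [MetricSpace Y] [MeasurableSpace Y] : Type _ :=
  {p : ProbabilityMeasure Y // MemPt t p}

/-- The `t`-Wasserstein topology on `𝒫_t(Y)`: the initial topology for the maps
`p ↦ ∫ g dp`, `g ∈ Φ_t(Y)`. -/
noncomputable instance (t : ℝ) (Y : Type*) [MetricSpace Y] [MeasurableSpace Y] :
    TopologicalSpace (PtSpace t Y) :=
  ⨅ g ∈ PhiT t Y,
    TopologicalSpace.induced
      (fun p : PtSpace t Y => ∫ y, g y ∂((p.1 : Measure Y))) inferInstance

variable {X Y : Type*} [MetricSpace X] [PolishSpace X] [MeasurableSpace X] [BorelSpace X]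
  [MetricSpace Y] [PolishSpace Y] [MeasurableSpace Y] [BorelSpace Y] [Nonempty Y]

/-- `π` is a coupling of `μ` and `ν`. -/
def IsCoupling (μ : ProbabilityMeasure X) (ν : ProbabilityMeasure Y)
    (π : ProbabilityMeasure (X × Y)) : Prop :=
  (π : Measure (X × Y)).map Prod.fst = (μ : Measure X) ∧
    (π : Measure (X × Y)).map Prod.snd = (ν : Measure Y)

/-- The disintegration `x ↦ π_x` of a coupling with respect to its first marginal,
as a map into probability measures. -/
noncomputable def disint (π : ProbabilityMeasure (X × Y)) (x : X) : ProbabilityMeasure Y :=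
  ⟨(π : Measure (X × Y)).condKernel x, inferInstance⟩

/-- The weak transport cost `∫ C(x, π_x) μ(dx)` of a coupling `π`, for a real-valued cost. -/
noncomputable def weakCostR (C : X → ProbabilityMeasure Y → ℝ)
    (μ : ProbabilityMeasure X) (π : ProbabilityMeasure (X × Y)) : ℝ :=
  ∫ x, C x (disint π x) ∂(μ : Measure X)

/-- `C`-monotonicity of a set `Γ ⊆ X × 𝒫_t(Y)`, for a real-valued cost. -/
def CMonotoneR (t : ℝ) (C : X → ProbabilityMeasure Y → ℝ)
    (Γ : Set (X × ProbabilityMeasure Y)) : Prop :=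
  ∀ (N : ℕ) (x : Fin N → X) (p q : Fin N → ProbabilityMeasure Y),
    (∀ k, (x k, p k) ∈ Γ) → (∀ k, MemPt t (q k)) →
    (∑ k, ((p k : Measure Y)) = ∑ k, ((q k : Measure Y))) →
    (∑ k, C (x k) (p k)) ≤ ∑ k, C (x k) (q k)

open Filter Topology Set

section Moments

variable {t : ℝ} {Z : Type*} [MetricSpace Z]

/-- Points at bounded distance have comparable growth of order `t`. -/
lemma one_add_dist_rpow_le (ht : 0 ≤ t) {z₀ y z : Z} {D : ℝ} (hD : dist y z ≤ D) :
    1 + dist z z₀ ^ t ≤ (1 + 2 ^ t * D ^ t + 2 ^ t) * (1 + dist y z₀ ^ t) := by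
  have hD0 : 0 ≤ D := dist_nonneg.trans hD
  have h1 : dist z z₀ ≤ 2 * max D (dist y z₀) := by
    have := dist_triangle z y z₀
    rw [dist_comm z y] at this
    have h2 := le_max_left D (dist y z₀)
    have h3 := le_max_right D (dist y z₀)
    linarith
  have h2 : dist z z₀ ^ t ≤ 2 ^ t * (max D (dist y z₀)) ^ t := by
    rw [← Real.mul_rpow (by norm_num) (le_max_of_le_left hD0)]
    exact Real.rpow_le_rpow dist_nonneg h1 ht
  have a := Real.rpow_nonneg hD0 t
  have b := Real.rpow_nonneg (dist_nonneg (x := y) (y := z₀)) t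
  have h3 : (max D (dist y z₀)) ^ t ≤ D ^ t + dist y z₀ ^ t := by
    rcases max_choice D (dist y z₀) with h | h <;> rw [h] <;> linarith
  have c : (0 : ℝ) ≤ 2 ^ t := by positivity
  have := mul_le_mul_of_nonneg_left h3 c
  have : 0 ≤ (2 : ℝ) ^ t * D ^ t * dist y z₀ ^ t := by positivity
  nlinarith

lemma one_le_one_add_dist_rpow (z z₀ : Z) : 1 ≤ 1 + dist z z₀ ^ t := by
  have := Real.rpow_nonneg (dist_nonneg (x := z) (y := z₀)) t
  linarith

lemma continuous_one_add_dist_rpow (ht : 0 ≤ t) (z₀ : Z) :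
    Continuous fun z : Z => 1 + dist z z₀ ^ t :=
  continuous_const.add ((continuous_id.dist continuous_const).rpow_const fun _ => Or.inr ht)

lemma one_add_dist_rpow_mem_phiT (ht : 0 ≤ t) (z₀ : Z) :
    (fun z : Z => 1 + dist z z₀ ^ t) ∈ PhiT t Z :=
  ⟨continuous_one_add_dist_rpow ht z₀, 1, z₀, fun z => by
    rw [abs_of_nonneg (zero_le_one.trans (one_le_one_add_dist_rpow z z₀)), one_mul]⟩

/-- The growth of a function in `Φ_t` can be measured from any base point. -/
lemma exists_abs_le_of_mem_phiT (ht : 0 ≤ t) (z₀ : Z) {g : Z → ℝ} (hg : g ∈ PhiT t Z) :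
    ∃ K : ℝ, 0 ≤ K ∧ ∀ z, |g z| ≤ K * (1 + dist z z₀ ^ t) := by
  obtain ⟨-, K, z₁, hK⟩ := hg
  refine ⟨|K| * (1 + 2 ^ t * dist z₀ z₁ ^ t + 2 ^ t), by positivity, fun z => ?_⟩
  have h1 := one_le_one_add_dist_rpow (t := t) z z₁
  have h2 := one_add_dist_rpow_le ht (z₀ := z) (le_refl (dist z₀ z₁))
  rw [dist_comm z₁ z, dist_comm z₀ z] at h2
  calc |g z| ≤ K * (1 + dist z z₁ ^ t) := hK z
    _ ≤ |K| * (1 + dist z z₁ ^ t) :=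
      mul_le_mul_of_nonneg_right (le_abs_self K) (zero_le_one.trans h1)
    _ ≤ _ := by
      rw [mul_assoc]
      exact mul_le_mul_of_nonneg_left h2 (abs_nonneg K)

variable [MeasurableSpace Z]

lemma tendsto_ptSpace_iff {α : Type*} {l : Filter α} {f : α → PtSpace t Z} {p : PtSpace t Z} :
    Tendsto f l (𝓝 p) ↔ ∀ g ∈ PhiT t Z,
      Tendsto (fun a => ∫ z, g z ∂((f a).1 : Measure Z)) l (𝓝 (∫ z, g z ∂(p.1 : Measure Z))) := by
  simp only [nhds_iInf, nhds_induced, tendsto_iInf, tendsto_comap_iff]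
  rfl

lemma continuous_ptSpace_integral {g : Z → ℝ} (hg : g ∈ PhiT t Z) :
    Continuous fun p : PtSpace t Z => ∫ z, g z ∂(p.1 : Measure Z) :=
  continuous_iff_continuousAt.2 fun _ => tendsto_ptSpace_iff.1 tendsto_id g hg

lemma memPt_of_integrable {p : ProbabilityMeasure Z} {z₀ : Z}
    (h : Integrable (fun z => 1 + dist z z₀ ^ t) (p : Measure Z)) : MemPt t p := by
  refine ⟨z₀, ?_⟩
  simpa [Pi.sub_def] using h.sub (integrable_const (1 : ℝ))

variable [BorelSpace Z]

lemma integrable_of_abs_le_one_add_dist_rpow {m : Measure Z} {z₀ : Z} {g : Z → ℝ} {K : ℝ}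
    (hg : Continuous g) [SecondCountableTopology Z]
    (hm : Integrable (fun z => 1 + dist z z₀ ^ t) m)
    (hK : ∀ z, |g z| ≤ K * (1 + dist z z₀ ^ t)) : Integrable g m :=
  (hm.const_mul K).mono' hg.aestronglyMeasurable (ae_of_all _ hK)

lemma MemPt.integrable [SecondCountableTopology Z] (ht : 0 ≤ t) {p : ProbabilityMeasure Z}
    (hp : MemPt t p) {g : Z → ℝ} (hg : g ∈ PhiT t Z) : Integrable g (p : Measure Z) := by
  obtain ⟨z₀, h⟩ := hp
  obtain ⟨K, -, hK⟩ := exists_abs_le_of_mem_phiT ht z₀ hg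
  exact integrable_of_abs_le_one_add_dist_rpow hg.1 ((integrable_const 1).add h) hK

lemma memPt_dirac (z : Z) : MemPt t (⟨Measure.dirac z, inferInstance⟩ : ProbabilityMeasure Z) :=
  ⟨z, integrable_dirac (by simp)⟩

end Moments

section Mixture

variable {t : ℝ} {Z : Type*} [MetricSpace Z] [MeasurableSpace Z]
  {ι : Type*} [Fintype ι]

lemma continuous_stdSimplex_apply (i : ι) : Continuous fun a : stdSimplex ℝ ι => a i :=
  (continuous_apply i).comp continuous_subtype_val

lemma integrable_mixture {a : ι → ℝ} {ρ : ι → PtSpace t Z} {g : Z → ℝ}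
    (h : ∀ i, Integrable g ((ρ i).1 : Measure Z)) :
    Integrable g (∑ i, ENNReal.ofReal (a i) • ((ρ i).1 : Measure Z)) :=
  integrable_finsetSum_measure.2 fun i _ => (h i).smul_measure ENNReal.ofReal_ne_top

/-- The mixture `∑ a_i ρ_i` of finitely many elements of `𝒫_t`. -/
def mixture [BorelSpace Z] [SecondCountableTopology Z] [Nonempty Z] (ht : 0 ≤ t)
    (a : stdSimplex ℝ ι) (ρ : ι → PtSpace t Z) : PtSpace t Z :=
  ⟨⟨∑ i, ENNReal.ofReal (a i) • ((ρ i).1 : Measure Z), ⟨by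
      simp only [Measure.coe_finsetSum, Finset.sum_apply, Measure.smul_apply, measure_univ,
        smul_eq_mul, mul_one]
      rw [← ENNReal.ofReal_sum_of_nonneg fun i _ => stdSimplex.zero_le a i,
        stdSimplex.sum_eq_one, ENNReal.ofReal_one]⟩⟩,
    memPt_of_integrable (z₀ := Classical.arbitrary Z) <| integrable_mixture fun i =>
      (ρ i).2.integrable ht (one_add_dist_rpow_mem_phiT ht _)⟩

variable [BorelSpace Z] [SecondCountableTopology Z] [Nonempty Z]

lemma coe_mixture (ht : 0 ≤ t) (a : stdSimplex ℝ ι) (ρ : ι → PtSpace t Z) :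
    ((mixture ht a ρ).1 : Measure Z) = ∑ i, ENNReal.ofReal (a i) • ((ρ i).1 : Measure Z) := rfl

lemma integral_mixture (ht : 0 ≤ t) (a : stdSimplex ℝ ι) (ρ : ι → PtSpace t Z) {g : Z → ℝ}
    (hg : g ∈ PhiT t Z) :
    ∫ z, g z ∂((mixture ht a ρ).1 : Measure Z) =
      ∑ i, a i * ∫ z, g z ∂((ρ i).1 : Measure Z) := by
  rw [coe_mixture, integral_finsetSum_measure fun i _ =>
    ((ρ i).2.integrable ht hg).smul_measure ENNReal.ofReal_ne_top]
  simp [integral_smul_measure, ENNReal.toReal_ofReal (stdSimplex.zero_le a _)]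

lemma continuous_mixture (ht : 0 ≤ t) :
    Continuous fun q : stdSimplex ℝ ι × (ι → PtSpace t Z) => mixture ht q.1 q.2 := by
  refine continuous_iff_continuousAt.2 fun q => tendsto_ptSpace_iff.2 fun g hg => ?_
  simp_rw [integral_mixture ht _ _ hg]
  refine Continuous.tendsto (f := fun q : stdSimplex ℝ ι × (ι → PtSpace t Z) =>
    ∑ i, q.1 i * ∫ z, g z ∂((q.2 i).1 : Measure Z)) ?_ q
  refine continuous_finsetSum _ fun i _ => ?_
  exact ((continuous_stdSimplex_apply i).comp continuous_fst).mul
    ((continuous_ptSpace_integral hg).comp ((continuous_apply i).comp continuous_snd))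

end Mixture

section Sampling

/-- By the strong law of large numbers, the averages of a finite family of integrable functions
over suitable finite samples are close to the integrals. -/
lemma exists_sample {Z : Type*} [MeasurableSpace Z] (m : Measure Z) [IsProbabilityMeasure m]
    {P : Z → Prop} (hP : ∀ᵐ z ∂m, P z) (s : Finset {h : Z → ℝ // Integrable h m}) (n : ℕ) :
    ∃ N : ℕ, 0 < N ∧ ∃ z : Fin N → Z, (∀ k, P (z k)) ∧
      ∀ h ∈ s, |(∑ k, h.1 (z k)) / N - ∫ y, h.1 y ∂m| < 1 / (n + 1) := by
  let M : Measure (ℕ → Z) := Measure.infinitePi fun _ => m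
  have hev (k : ℕ) : MeasurePreserving (Function.eval k) M m :=
    measurePreserving_eval_infinitePi _ k
  have hPall : ∀ᵐ ω ∂M, ∀ k, P (ω k) :=
    ae_all_iff.2 fun k => (hev k).quasiMeasurePreserving.ae hP
  have hlaw : ∀ᵐ ω ∂M, ∀ h ∈ s, Tendsto (fun n : ℕ => (∑ k ∈ Finset.range n, h.1 (ω k)) / n)
      atTop (𝓝 (∫ y, h.1 y ∂m)) := by
    refine (Finset.eventually_all s).2 fun h _ => ?_
    let f := h.2.1.mk h.1
    have hf : StronglyMeasurable f := h.2.1.stronglyMeasurable_mk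
    have hfh : h.1 =ᵐ[m] f := h.2.1.ae_eq_mk
    have hfi : Integrable f m := h.2.congr hfh
    have hae : ∀ᵐ ω ∂M, ∀ k, h.1 (ω k) = f (ω k) :=
      ae_all_iff.2 fun k => (hev k).quasiMeasurePreserving.ae hfh
    have hind : iIndepFun (fun (k : ℕ) (ω : ℕ → Z) => f (ω k)) M :=
      iIndepFun_infinitePi (X := fun _ => f) fun _ => hf.measurable
    have hL := strong_law_ae_real (μ := M) (fun (k : ℕ) (ω : ℕ → Z) => f (ω k))
      ((hev 0).integrable_comp_of_integrable hfi) (fun i j hij => hind.indepFun hij)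
      fun i => by
        refine ⟨(hf.measurable.comp (measurable_pi_apply i)).aemeasurable,
          (hf.measurable.comp (measurable_pi_apply 0)).aemeasurable, ?_⟩
        have (j : ℕ) : M.map (fun ω => f (ω j)) = m.map f := by
          rw [← (hev j).map_eq, Measure.map_map hf.measurable (measurable_pi_apply j)]
          rfl
        rw [this, this]
    filter_upwards [hL, hae] with ω h1 h2
    have : ∫ ω, f (ω 0) ∂M = ∫ y, h.1 y ∂m := by
      rw [integral_congr_ae hfh, ← (hev 0).map_eq,
        integral_map (measurable_pi_apply 0).aemeasurable hf.aestronglyMeasurable]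
    rw [this] at h1
    simpa only [h2] using h1
  obtain ⟨ω, h1, h2⟩ := (hPall.and hlaw).exists
  have h3 : ∀ᶠ N : ℕ in atTop, ∀ h ∈ s,
      |(∑ k ∈ Finset.range N, h.1 (ω k)) / N - ∫ y, h.1 y ∂m| < 1 / (n + 1) := by
    refine (Finset.eventually_all s).2 fun h hh => ?_
    have := Metric.tendsto_nhds.1 (h2 h hh) (1 / (n + 1)) (by positivity)
    simpa only [Real.dist_eq] using this
  obtain ⟨N, hN, hN0⟩ := (h3.and (eventually_gt_atTop 0)).exists
  refine ⟨N, hN0, fun k => ω k, fun k => h1 k, fun h hh => ?_⟩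
  have := hN h hh
  rwa [Finset.sum_range] at this

/-- There is a net of finite samples along which the empirical averages of every integrable
function converge to its integral. -/
lemma exists_sample_net.{v} {Z : Type v} [MeasurableSpace Z] (m : Measure Z)
    [IsProbabilityMeasure m] {P : Z → Prop} (hP : ∀ᵐ z ∂m, P z) :
    ∃ (D : Type v) (F : Filter D) (_ : F.NeBot) (N : D → ℕ) (z : ∀ d, Fin (N d) → Z),
      (∀ d, 0 < N d) ∧ (∀ d k, P (z d k)) ∧ ∀ h : Z → ℝ, Integrable h m →
        Tendsto (fun d => (∑ k, h (z d k)) / N d) F (𝓝 (∫ y, h y ∂m)) := by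
  choose N hN z hz hs using fun d : Finset {h : Z → ℝ // Integrable h m} × ℕ =>
    exists_sample m hP d.1 d.2
  classical
  refine ⟨Finset {h : Z → ℝ // Integrable h m} × ℕ, atTop, inferInstance, N, z, hN, hz,
    fun h hh => ?_⟩
  refine Metric.tendsto_nhds.2 fun ε hε => ?_
  obtain ⟨n, hn⟩ := exists_nat_one_div_lt hε
  filter_upwards [eventually_ge_atTop (({⟨h, hh⟩}, n) :
    Finset {h : Z → ℝ // Integrable h m} × ℕ)] with d hd
  refine (hs d ⟨h, hh⟩ (hd.1 (Finset.mem_singleton_self _))).trans (lt_of_le_of_lt ?_ hn)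
  have : (n : ℝ) ≤ d.2 := by exact_mod_cast hd.2
  gcongr

end Sampling
section Kernels

lemma integral_comp_measure {α β : Type*} [MeasurableSpace α] [MeasurableSpace β]
    {m : Measure α} [SFinite m] {n : Measure β} {κ : Kernel α β} [IsSFiniteKernel κ]
    (hκ : κ ∘ₘ m = n) {f : β → ℝ} (hf : Integrable f n) :
    (∀ᵐ x ∂m, Integrable f (κ x)) ∧ Integrable (fun x => ∫ y, f y ∂κ x) m ∧
      ∫ x, ∫ y, f y ∂κ x ∂m = ∫ y, f y ∂n := by
  subst hκ
  rw [Measure.comp_eq_comp_const_apply] at hf ⊢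
  exact ⟨hf.ae_of_comp, hf.integral_comp, (Kernel.integral_comp hf).symm⟩

/-- The values of a Markov kernel, as bundled probability measures. -/
def kernelProb {α β : Type*} [MeasurableSpace α] [MeasurableSpace β] (κ : Kernel α β)
    [IsMarkovKernel κ] (x : α) : ProbabilityMeasure β :=
  ⟨κ x, inferInstance⟩

end Kernels

section Comparison

variable {t : ℝ} {Z : Type*} [MetricSpace Z] [MeasurableSpace Z]

lemma exists_normalization {s : Measure Z} [IsFiniteMeasure s] {z₀ : Z}
    (hs : Integrable (fun z => 1 + dist z z₀ ^ t) s) (ρ : PtSpace t Z) :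
    ∃ r : PtSpace t Z, s univ • (r.1 : Measure Z) = s ∧ (s univ = 0 → r = ρ) := by
  by_cases h : s univ = 0
  · exact ⟨ρ, by rw [h, zero_smul, Measure.measure_univ_eq_zero.1 h], fun _ => rfl⟩
  · have hp : IsProbabilityMeasure ((s univ)⁻¹ • s) :=
      ⟨by simp [ENNReal.inv_mul_cancel h (measure_ne_top s univ)]⟩
    refine ⟨⟨⟨(s univ)⁻¹ • s, hp⟩,
      memPt_of_integrable (z₀ := z₀) (hs.smul_measure (ENNReal.inv_ne_top.2 h))⟩, ?_,
      fun h' => absurd h' h⟩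
    change s univ • ((s univ)⁻¹ • s) = s
    rw [smul_smul, ENNReal.mul_inv_cancel h (measure_ne_top s univ), one_smul]

/-- Convergence of unnormalized integrals and of masses gives convergence in `𝒫_t`. -/
lemma tendsto_ptSpace_of_tendsto_mul {D : Type*} {F : Filter D} {r : D → PtSpace t Z}
    {ρ : PtSpace t Z} {β : D → ℝ} {w : ℝ} (hβ : Tendsto β F (𝓝 w))
    (h : ∀ g ∈ PhiT t Z, Tendsto (fun d => β d * ∫ z, g z ∂((r d).1 : Measure Z)) F
      (𝓝 (w * ∫ z, g z ∂(ρ.1 : Measure Z)))) (h0 : w = 0 → ∀ d, r d = ρ) :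
    Tendsto r F (𝓝 ρ) := by
  by_cases hw : w = 0
  · rw [funext (h0 hw)]
    exact tendsto_const_nhds
  · refine tendsto_ptSpace_iff.2 fun g hg => ?_
    have := (h g hg).div hβ hw
    rw [mul_div_cancel_left₀ _ hw] at this
    refine this.congr' ?_
    filter_upwards [hβ.eventually_ne hw] with d hd
    simp [mul_div_cancel_left₀ _ hd]

variable {W : Type*} [TopologicalSpace W] [BorelSpace Z] [SecondCountableTopology Z] [Nonempty Z]
  {ι : Type*} [Fintype ι]

/-- Continuous functions of mixtures converge uniformly over compact sets when the weights and
the components converge. -/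
lemma eventually_forall_abs_mixture_sub_lt (ht : 0 ≤ t) {C : W → ProbabilityMeasure Z → ℝ}
    (hC : Continuous fun q : W × PtSpace t Z => C q.1 q.2.1) {D : Type*} {F : Filter D}
    {T : D → stdSimplex ℝ ι → stdSimplex ℝ ι} {r : D → ι → PtSpace t Z} {ρ : ι → PtSpace t Z}
    (hr : Tendsto r F (𝓝 ρ))
    (hT : ∀ a, Tendsto (fun q : D × stdSimplex ℝ ι => T q.1 q.2) (F ×ˢ 𝓝 a) (𝓝 a))
    {K : Set W} (hK : IsCompact K) {ε : ℝ} (hε : 0 < ε) :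
    ∀ᶠ d in F, ∀ x ∈ K, ∀ a : stdSimplex ℝ ι,
      |C x (mixture ht (T d a) (r d)).1 - C x (mixture ht a ρ).1| < ε := by
  have hG : Continuous fun q : W × stdSimplex ℝ ι × (ι → PtSpace t Z) =>
      C q.1 (mixture ht q.2.1 q.2.2).1 :=
    hC.comp (continuous_fst.prodMk ((continuous_mixture ht).comp continuous_snd))
  have key : {q : D × W × stdSimplex ℝ ι | |C q.2.1 (mixture ht (T q.1 q.2.2) (r q.1)).1 -
      C q.2.1 (mixture ht q.2.2 ρ).1| < ε} ∈ F ×ˢ 𝓝ˢ (K ×ˢ (univ : Set (stdSimplex ℝ ι))) := by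
    refine (hK.prod isCompact_univ).mem_prod_nhdsSet_of_forall fun ⟨x, a⟩ _ => ?_
    have hx : Tendsto (fun q : D × W × stdSimplex ℝ ι => q.2.1) (F ×ˢ 𝓝 (x, a)) (𝓝 x) :=
      (continuous_fst.tendsto (x, a)).comp tendsto_snd
    have ha : Tendsto (fun q : D × W × stdSimplex ℝ ι => q.2.2) (F ×ˢ 𝓝 (x, a)) (𝓝 a) :=
      (continuous_snd.tendsto (x, a)).comp tendsto_snd
    have hTa : Tendsto (fun q : D × W × stdSimplex ℝ ι => T q.1 q.2.2) (F ×ˢ 𝓝 (x, a)) (𝓝 a) :=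
      (hT a).comp (tendsto_fst.prodMk ha)
    have h1 := (hG.tendsto (x, a, ρ)).comp
      (hx.prodMk_nhds (hTa.prodMk_nhds (hr.comp tendsto_fst)))
    have h2 := (hG.tendsto (x, a, ρ)).comp
      (hx.prodMk_nhds (ha.prodMk_nhds (tendsto_const_nhds (x := ρ))))
    have h3 := h1.sub h2
    rw [sub_self] at h3
    have := Metric.tendsto_nhds.1 h3 ε hε
    filter_upwards [this] with q hq
    simpa [Real.dist_eq] using hq
  obtain ⟨s, hs, u, hu, hsu⟩ := Filter.mem_prod_iff.1 key
  filter_upwards [hs] with d hd x hx a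
  exact hsu (show (d, x, a) ∈ s ×ˢ u from
    ⟨hd, subset_of_mem_nhdsSet hu ⟨hx, mem_univ a⟩⟩)

end Comparison

section Weights

variable {ι : Type*} [Fintype ι]

/-- If the averages `α` of weights and the target averages `β` are close to each other, then
weights with average `β` arise from weights with average `α` by a perturbation `a ↦ θ a + e` of
the identity of the simplex. -/
lemma exists_simplex_perturbation {D : Type*} {F : Filter D} {α β : D → ι → ℝ} {w : ι → ℝ}
    (hα : ∀ i, Tendsto (α · i) F (𝓝 (w i))) (hβ : ∀ i, Tendsto (β · i) F (𝓝 (w i)))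
    (hα1 : ∀ d, ∑ i, α d i = 1) (hβ1 : ∀ d, ∑ i, β d i = 1) (hw : ∀ i, 0 ≤ w i)
    (h0 : ∀ i, w i = 0 → ∀ d, α d i = 0 ∧ β d i = 0) :
    ∃ (θ : D → ℝ) (T : D → stdSimplex ℝ ι → stdSimplex ℝ ι),
      (∀ᶠ d in F, ∀ a i, T d a i = θ d * a i + (β d i - θ d * α d i)) ∧
      ∀ a, Tendsto (fun q : D × stdSimplex ℝ ι => T q.1 q.2) (F ×ˢ 𝓝 a) (𝓝 a) := by
  classical
  let θ : D → ℝ := fun d => 1 - ∑ i, 2 / w i * |α d i - β d i|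
  have hθ : Tendsto θ F (𝓝 1) := by
    have : Tendsto θ F (𝓝 (1 - ∑ i, 2 / w i * |w i - w i|)) :=
      tendsto_const_nhds.sub <| tendsto_finsetSum _ fun i _ =>
        tendsto_const_nhds.mul ((hα i).sub (hβ i)).abs
    simpa using this
  let T : D → stdSimplex ℝ ι → stdSimplex ℝ ι := fun d a =>
    if h : (fun i => θ d * a i + (β d i - θ d * α d i)) ∈ stdSimplex ℝ ι then ⟨_, h⟩ else a
  have hT : ∀ᶠ d in F, ∀ a i, T d a i = θ d * a i + (β d i - θ d * α d i) := by
    have hhalf : ∀ᶠ d in F, ∀ i, w i ≠ 0 → w i / 2 ≤ α d i := by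
      refine eventually_all.2 fun i => ?_
      by_cases hi : w i = 0
      · simp [hi]
      · have : w i / 2 < w i := half_lt_self (lt_of_le_of_ne (hw i) (Ne.symm hi))
        filter_upwards [(hα i).eventually (eventually_gt_nhds this)] with d hd _ using hd.le
    filter_upwards [hhalf, hθ.eventually (eventually_gt_nhds zero_lt_one)] with d hd hθd a i
    have he (i : ι) : 0 ≤ β d i - θ d * α d i := by
      by_cases hi : w i = 0
      · simp [h0 i hi d]
      · have hwi := lt_of_le_of_ne (hw i) (Ne.symm hi)
        have h1 : 2 / w i * |α d i - β d i| ≤ 1 - θ d := by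
          have := Finset.single_le_sum (f := fun i => 2 / w i * |α d i - β d i|)
            (fun j _ => mul_nonneg (div_nonneg zero_le_two (hw j)) (abs_nonneg _))
            (Finset.mem_univ i)
          simp only [θ]
          linarith
        have h2 : |α d i - β d i| ≤ (1 - θ d) * α d i := by
          calc |α d i - β d i| = (2 / w i * |α d i - β d i|) * (w i / 2) := by field_simp
            _ ≤ (1 - θ d) * α d i := by
              refine mul_le_mul h1 (hd i hi) (by positivity) (le_trans ?_ h1)
              positivity
        have := le_abs_self (α d i - β d i)
        nlinarith
    have hmem : (fun i => θ d * a i + (β d i - θ d * α d i)) ∈ stdSimplex ℝ ι := by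
      refine ⟨fun i => add_nonneg (mul_nonneg hθd.le (stdSimplex.zero_le a i)) (he i), ?_⟩
      rw [Finset.sum_add_distrib, Finset.sum_sub_distrib, ← Finset.mul_sum, ← Finset.mul_sum,
        stdSimplex.sum_eq_one, hα1, hβ1]
      ring
    simp only [T, dif_pos hmem]
    rfl
  refine ⟨θ, T, hT, fun a => ?_⟩
  refine tendsto_subtype_rng.2 (tendsto_pi_nhds.2 fun i => ?_)
  have h1 : Tendsto (fun q : D × stdSimplex ℝ ι =>
      θ q.1 * q.2 i + (β q.1 i - θ q.1 * α q.1 i)) (F ×ˢ 𝓝 a)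
      (𝓝 (1 * a i + (w i - 1 * w i))) := by
    have hθ' := hθ.comp (tendsto_fst (f := F) (g := 𝓝 a))
    refine (hθ'.mul (((continuous_stdSimplex_apply i).tendsto a).comp tendsto_snd)).add ?_
    exact ((hβ i).comp tendsto_fst).sub (hθ'.mul ((hα i).comp tendsto_fst))
  have h2 : 1 * a i + (w i - 1 * w i) = a i := by ring
  rw [h2] at h1
  refine h1.congr' ?_
  filter_upwards [tendsto_fst.eventually hT] with q hq
  exact (hq q.2 i).symm

end Weights

section FiniteRank

variable {t : ℝ}

/-- The part of an integrable function outside a large compact set has small integral. -/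
lemma exists_isCompact_integral_compl_lt {μ : Measure X} [IsFiniteMeasure μ] {f : X → ℝ}
    (hf : Integrable f μ) (hf0 : ∀ x, 0 ≤ f x) {ε : ℝ} (hε : 0 < ε) :
    ∃ K : Set X, IsCompact K ∧ ∫ x, Kᶜ.indicator f x ∂μ < ε := by
  obtain ⟨δ, hδ, h⟩ := exists_pos_setLIntegral_lt_of_measure_lt
    (μ := μ) (f := fun x => ENNReal.ofReal (f x))
    (hf.lintegral_lt_top.ne) (ε := ENNReal.ofReal ε) (by simpa using hε)
  obtain ⟨K, hK, hKδ⟩ := isTightMeasureSet_iff_exists_isCompact_measure_compl_le.1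
    (isTightMeasureSet_singleton (μ := μ)) (min (δ / 2) 1) (by simp [hδ.ne'])
  have h1 : μ Kᶜ < δ := by
    refine (hKδ μ rfl).trans_lt ?_
    rcases eq_or_ne δ ⊤ with rfl | hδ'
    · exact (min_le_right _ _).trans_lt ENNReal.one_lt_top
    · exact (min_le_left _ _).trans_lt (ENNReal.half_lt_self hδ.ne' hδ')
  refine ⟨K, hK, ?_⟩
  rw [integral_indicator hK.isClosed.measurableSet.compl,
    integral_eq_lintegral_of_nonneg_ae (ae_of_all _ hf0) hf.1.restrict]
  exact ENNReal.toReal_lt_of_lt_ofReal (h _ h1)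

/-- Monotonicity tested against mixtures of the cell averages of the measures `p k`. -/
lemma CMonotoneR.sum_le_sum {W ι : Type*} [Fintype ι]
    [MeasurableSpace ι] [MeasurableSingletonClass ι] (ht : 0 ≤ t)
    {C : W → ProbabilityMeasure Y → ℝ} {Γ : Set (W × ProbabilityMeasure Y)}
    (hΓ : CMonotoneR t C Γ)
    {c : Y → ι} (hc : Measurable c) {N : ℕ} {x : Fin N → W} {p : Fin N → ProbabilityMeasure Y}
    (hp : ∀ k, (x k, p k) ∈ Γ) {r : ι → PtSpace t Y}
    (hr : ∀ i, (∑ k, (p k : Measure Y).restrict (c ⁻¹' {i})) univ • ((r i).1 : Measure Y) =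
      ∑ k, (p k : Measure Y).restrict (c ⁻¹' {i}))
    {b : Fin N → stdSimplex ℝ ι}
    (hb : ∀ i, ∑ k, b k i = ∑ k, (p k : Measure Y).real (c ⁻¹' {i})) :
    ∑ k, C (x k) (p k) ≤ ∑ k, C (x k) (mixture ht (b k) r).1 := by
  refine hΓ N x p (fun k => (mixture ht (b k) r).1) hp (fun k => (mixture ht (b k) r).2) ?_
  have hsplit (k : Fin N) : (p k : Measure Y) =
      ∑ i, (p k : Measure Y).restrict (c ⁻¹' {i}) := by
    have h := Measure.restrict_iUnion (μ := (p k : Measure Y)) (s := fun i => c ⁻¹' {i})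
      (fun i j hij => Disjoint.preimage c (by simpa using hij))
      (fun i => hc (measurableSet_singleton i))
    have hu : ⋃ i, c ⁻¹' {i} = univ := by ext; simp
    rw [hu, Measure.restrict_univ] at h
    rw [← Measure.sum_fintype]
    exact h
  calc ∑ k, (p k : Measure Y) = ∑ k, ∑ i, (p k : Measure Y).restrict (c ⁻¹' {i}) :=
        Finset.sum_congr rfl fun k _ => hsplit k
    _ = ∑ i, ∑ k, (p k : Measure Y).restrict (c ⁻¹' {i}) := Finset.sum_comm
    _ = ∑ i, ∑ k, ENNReal.ofReal (b k i) • ((r i).1 : Measure Y) := by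
        refine Finset.sum_congr rfl fun i _ => ?_
        rw [← hr i, ← Finset.sum_smul, ← ENNReal.ofReal_sum_of_nonneg
          fun k _ => stdSimplex.zero_le (b k) i, hb, ENNReal.ofReal_sum_of_nonneg
          fun k _ => measureReal_nonneg]
        simp [Measure.finsetSum_apply]
    _ = ∑ k, ((mixture ht (b k) r).1 : Measure Y) := by
        rw [Finset.sum_comm]
        rfl

/-- A `C`-monotone kernel costs at most as much as any finite-rank kernel with the same second
marginal. -/
theorem integral_le_integral_mixture (ht : 0 ≤ t) {C : X → ProbabilityMeasure Y → ℝ}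
    (hcont : Continuous fun q : X × PtSpace t Y => C q.1 q.2.1)
    {R : ℝ} (hR : 0 ≤ R) {x₀ : X} {y₀ : Y}
    (hbound : ∀ x p, MemPt t p →
      |C x p| ≤ R * ((1 + dist x x₀ ^ t) + ∫ y, (1 + dist y y₀ ^ t) ∂(p : Measure Y)))
    {μ : ProbabilityMeasure X} {ν : ProbabilityMeasure Y} (hμ : MemPt t μ) (hν : MemPt t ν)
    {κ : Kernel X Y} [IsMarkovKernel κ] (hκ : κ ∘ₘ (μ : Measure X) = ν)
    {Γ : Set (X × ProbabilityMeasure Y)} (hΓp : ∀ xp ∈ Γ, MemPt t xp.2)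
    (hΓ : CMonotoneR t C Γ) (hκΓ : ∀ᵐ x ∂(μ : Measure X), (x, kernelProb κ x) ∈ Γ)
    (h_int : Integrable (fun x => C x (kernelProb κ x)) (μ : Measure X))
    {ι : Type*} [Fintype ι] [MeasurableSpace ι] [MeasurableSingletonClass ι]
    {c : Y → ι} (hc : Measurable c) {ρ : ι → PtSpace t Y}
    (hρ : ∀ i, (ν : Measure Y) (c ⁻¹' {i}) • ((ρ i).1 : Measure Y) =
      (ν : Measure Y).restrict (c ⁻¹' {i}))
    {a : X → stdSimplex ℝ ι} (ha : Measurable a)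
    (hai : ∀ i, ∫ x, a x i ∂(μ : Measure X) = (ν : Measure Y).real (c ⁻¹' {i})) :
    ∫ x, C x (kernelProb κ x) ∂(μ : Measure X) ≤
      ∫ x, C x (mixture ht (a x) ρ).1 ∂(μ : Measure X) := by
  have hS (i : ι) : MeasurableSet (c ⁻¹' {i}) := hc (measurableSet_singleton i)
  have hameas (i : ι) : Measurable fun x => a x i :=
    (continuous_stdSimplex_apply i).measurable.comp ha
  have haint (i : ι) : Integrable (fun x => a x i) (μ : Measure X) :=
    Integrable.of_bound (hameas i).aestronglyMeasurable 1 <| ae_of_all _ fun x => by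
      rw [Real.norm_of_nonneg (stdSimplex.zero_le _ i)]
      exact stdSimplex.le_one (a x) i
  have hgint {g : Y → ℝ} (hg : g ∈ PhiT t Y) (i : ι) :=
    integral_comp_measure hκ ((hν.integrable ht hg).indicator (hS i))
  have hone : (fun _ : Y => (1 : ℝ)) ∈ PhiT t Y :=
    ⟨continuous_const, 1, y₀, fun y => by
      simpa using Real.rpow_nonneg (dist_nonneg (x := y) (y := y₀)) t⟩
  have hP : ∀ᵐ x ∂(μ : Measure X), (x, kernelProb κ x) ∈ Γ ∧
      ∀ i, (ν : Measure Y).real (c ⁻¹' {i}) = 0 → κ x (c ⁻¹' {i}) = 0 ∧ a x i = 0 := by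
    refine hκΓ.and (ae_all_iff.2 fun i => ?_)
    by_cases hi : (ν : Measure Y).real (c ⁻¹' {i}) = 0
    · have h1 : ∀ᵐ x ∂(μ : Measure X), κ x (c ⁻¹' {i}) = 0 := by
        have h2 : (κ ∘ₘ (μ : Measure X)) (c ⁻¹' {i}) = 0 := by
          rw [hκ]
          exact (measureReal_eq_zero_iff).1 hi
        rw [Measure.bind_apply (hS i) κ.aemeasurable,
          lintegral_eq_zero_iff (κ.measurable_coe (hS i))] at h2
        exact h2
      have h3 : ∀ᵐ x ∂(μ : Measure X), a x i = 0 :=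
        (integral_eq_zero_iff_of_nonneg (fun x => stdSimplex.zero_le (a x) i) (haint i)).1
          ((hai i).trans hi)
      filter_upwards [h1, h3] with x hx hx' _ using ⟨hx, hx'⟩
    · exact ae_of_all _ fun x h => absurd h hi
  obtain ⟨D, F, hF, N, x, hN, hx, hlim⟩ := exists_sample_net (μ : Measure X) hP
  let σ : D → ι → Measure Y := fun d i => ∑ k, (κ (x d k)).restrict (c ⁻¹' {i})
  have hσint {g : Y → ℝ} (hg : g ∈ PhiT t Y) (d : D) (i : ι) (k : Fin (N d)) :
      Integrable g ((κ (x d k)).restrict (c ⁻¹' {i})) :=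
    ((hΓp _ (hx d k).1).integrable ht hg).restrict
  have hfin (d : D) (i : ι) : IsFiniteMeasure (σ d i) := by
    refine ⟨?_⟩
    simp only [σ, Measure.finsetSum_apply]
    exact ENNReal.sum_lt_top.2 fun k _ => measure_lt_top _ _
  choose r hr hr0 using fun d i => exists_normalization (s := σ d i) (z₀ := y₀)
    (integrable_finsetSum_measure.2 fun k _ => hσint (one_add_dist_rpow_mem_phiT ht y₀) d i k)
    (ρ i)
  have hσuniv (d : D) (i : ι) : (σ d i univ).toReal = ∑ k, (κ (x d k)).real (c ⁻¹' {i}) := by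
    simp only [σ, Measure.finsetSum_apply, Measure.restrict_apply_univ]
    rw [ENNReal.toReal_sum fun k _ => measure_ne_top _ _]
    rfl
  let α : D → ι → ℝ := fun d i => (∑ k, a (x d k) i) / N d
  let β : D → ι → ℝ := fun d i => (∑ k, (κ (x d k)).real (c ⁻¹' {i})) / N d
  have hα (i : ι) : Tendsto (α · i) F (𝓝 ((ν : Measure Y).real (c ⁻¹' {i}))) := by
    rw [← hai i]
    exact hlim _ (haint i)
  have hβ (i : ι) : Tendsto (β · i) F (𝓝 ((ν : Measure Y).real (c ⁻¹' {i}))) := by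
    have h := hgint hone i
    have h' := hlim _ h.2.1
    rw [h.2.2] at h'
    simpa [integral_indicator (hS i), β] using h'
  have hNpos (d : D) : (0 : ℝ) < N d := Nat.cast_pos.2 (hN d)
  have hα1 (d : D) : ∑ i, α d i = 1 := by
    simp only [α]
    rw [← Finset.sum_div, Finset.sum_comm]
    simp [stdSimplex.sum_eq_one, (hNpos d).ne']
  have hβ1 (d : D) : ∑ i, β d i = 1 := by
    simp only [β]
    rw [← Finset.sum_div, Finset.sum_comm]
    have (k : Fin (N d)) : ∑ i, (κ (x d k)).real (c ⁻¹' {i}) = 1 := by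
      rw [sum_measureReal_preimage_singleton Finset.univ fun i _ => hS i]
      simp
    simp [this, (hNpos d).ne']
  have hrρ : Tendsto r F (𝓝 ρ) := by
    refine tendsto_pi_nhds.2 fun i => tendsto_ptSpace_of_tendsto_mul (hβ i) (fun g hg => ?_) ?_
    · have h := hgint hg i
      have h' := hlim _ h.2.1
      rw [h.2.2] at h'
      simp only [integral_indicator (hS i)] at h'
      rw [← hρ i, integral_smul_measure] at h'
      refine h'.congr fun d => ?_
      have hd := congrArg (fun m : Measure Y => ∫ y, g y ∂m) (hr d i)
      simp only [integral_smul_measure, hσuniv, smul_eq_mul] at hd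
      rw [integral_finsetSum_measure fun k _ => hσint hg d i k] at hd
      rw [← hd]
      simp only [β]
      ring
    · intro hi d
      refine hr0 d i ?_
      simp [σ, Measure.finsetSum_apply, fun k => ((hx d k).2 i hi).1]
  obtain ⟨θ, T, hT, hTlim⟩ := exists_simplex_perturbation hα hβ hα1 hβ1
    (fun i => measureReal_nonneg) fun i hi d =>
      ⟨by simp [α, fun k => ((hx d k).2 i hi).2],
        by simp [β, Measure.real, fun k => ((hx d k).2 i hi).1]⟩
  have hmono : ∀ᶠ d in F, ∑ k, C (x d k) (kernelProb κ (x d k)) ≤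
      ∑ k, C (x d k) (mixture ht (T d (a (x d k))) (r d)).1 := by
    filter_upwards [hT] with d hd
    refine hΓ.sum_le_sum ht hc (fun k => (hx d k).1) (hr d) fun i => ?_
    simp only [hd, Finset.sum_add_distrib, ← Finset.mul_sum, Finset.sum_const, Finset.card_univ,
      Fintype.card_fin, nsmul_eq_mul]
    have h1 : ∑ k, a (x d k) i = N d * α d i := by
      simp only [α]
      field_simp [(hNpos d).ne']
    have h2 : ∑ k, (kernelProb κ (x d k) : Measure Y).real (c ⁻¹' {i}) = N d * β d i := by
      simp only [β]
      field_simp [(hNpos d).ne']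
      rfl
    rw [h1, h2]
    ring
  let h : Y → ℝ := fun y => 1 + dist y y₀ ^ t
  have hh : h ∈ PhiT t Y := one_add_dist_rpow_mem_phiT ht y₀
  have hh0 (p : ProbabilityMeasure Y) : 0 ≤ ∫ y, h y ∂(p : Measure Y) :=
    integral_nonneg fun y => zero_le_one.trans (one_le_one_add_dist_rpow y y₀)
  have hmix (b : stdSimplex ℝ ι) (s : ι → PtSpace t Y) :
      ∫ y, h y ∂((mixture ht b s).1 : Measure Y) ≤ ∑ i, ∫ y, h y ∂((s i).1 : Measure Y) := by
    rw [integral_mixture ht b s hh]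
    exact Finset.sum_le_sum fun i _ =>
      mul_le_of_le_one_left (hh0 _) (stdSimplex.le_one b i)
  set M : ℝ := ∑ i, ∫ y, h y ∂((ρ i).1 : Measure Y) with hM
  have hM0 : 0 ≤ M := Finset.sum_nonneg fun i _ => hh0 _
  have hMr : ∀ᶠ d in F, ∑ i, ∫ y, h y ∂((r d i).1 : Measure Y) < M + 1 := by
    have : Tendsto (fun d => ∑ i, ∫ y, h y ∂((r d i).1 : Measure Y)) F (𝓝 M) :=
      tendsto_finsetSum _ fun i _ =>
        tendsto_ptSpace_iff.1 (tendsto_pi_nhds.1 hrρ i) h hh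
    exact this.eventually (eventually_lt_nhds (lt_add_one M))
  let Ψ : X → ℝ := fun x => R * (2 * (1 + dist x x₀ ^ t) + (2 * M + 1))
  have hΦX : Integrable (fun x => 1 + dist x x₀ ^ t) (μ : Measure X) :=
    hμ.integrable ht (one_add_dist_rpow_mem_phiT ht x₀)
  have hΨint : Integrable Ψ (μ : Measure X) :=
    ((hΦX.const_mul 2).add (integrable_const _)).const_mul R
  have hX0 (x : X) : 0 ≤ 1 + dist x x₀ ^ t := zero_le_one.trans (one_le_one_add_dist_rpow x x₀)
  have hΨ0 (x : X) : 0 ≤ Ψ x := by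
    have := hX0 x
    positivity
  have hubound (x : X) : |C x (mixture ht (a x) ρ).1| ≤ R * ((1 + dist x x₀ ^ t) + M) :=
    (hbound _ _ (mixture ht (a x) ρ).2).trans
      (mul_le_mul_of_nonneg_left (by gcongr; exact hmix _ _) hR)
  have humeas : Measurable fun x => C x (mixture ht (a x) ρ).1 := by
    have hG : Continuous fun q : X × stdSimplex ℝ ι => C q.1 (mixture ht q.2 ρ).1 :=
      hcont.comp (continuous_fst.prodMk
        ((continuous_mixture ht).comp (continuous_snd.prodMk continuous_const)))
    exact hG.measurable.comp (measurable_id.prodMk ha)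
  have huint : Integrable (fun x => C x (mixture ht (a x) ρ).1) (μ : Measure X) :=
    ((hΦX.add (integrable_const M)).const_mul R).mono' humeas.aestronglyMeasurable
      (ae_of_all _ hubound)
  refine le_of_forall_pos_le_add fun ε hε => ?_
  obtain ⟨K, hK, hKε⟩ := exists_isCompact_integral_compl_lt hΨint hΨ0 (half_pos hε)
  have hindint : Integrable (Kᶜ.indicator Ψ) (μ : Measure X) :=
    hΨint.indicator hK.isClosed.measurableSet.compl
  have hunif := eventually_forall_abs_mixture_sub_lt ht hcont hrρ hTlim hK (half_pos hε)
  have hlimsum := hlim _ ((huint.add (integrable_const (ε / 2))).add hindint)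
  have hle := le_of_tendsto_of_tendsto (hlim _ h_int) hlimsum <| by
    filter_upwards [hmono, hMr, hunif] with d hd hdM hdu
    refine div_le_div_of_nonneg_right (hd.trans (Finset.sum_le_sum fun k _ => ?_)) (hNpos d).le
    simp only [Pi.add_apply]
    by_cases hkK : x d k ∈ K
    · have h1 := (abs_lt.1 (hdu _ hkK (a (x d k)))).2
      have h2 : Kᶜ.indicator Ψ (x d k) = 0 := indicator_of_notMem (by simpa using hkK) _
      linarith
    · have h2 : Kᶜ.indicator Ψ (x d k) = Ψ (x d k) := indicator_of_mem (by simpa using hkK) _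
      have h3 := (le_abs_self _).trans (hbound (x d k) _ (mixture ht (T d (a (x d k))) (r d)).2)
      have h4 := (neg_le_abs _).trans (hubound (x d k))
      have h5 := mul_le_mul_of_nonneg_left ((hmix (T d (a (x d k))) (r d)).trans hdM.le) hR
      simp only [h2, Ψ]
      simp only [h] at h5
      nlinarith
  rw [integral_add' (huint.add (integrable_const _)) hindint,
    integral_add' huint (integrable_const _), integral_const] at hle
  simp only [probReal_univ, one_smul] at hle
  linarith

end FiniteRank

section Partition

variable {t : ℝ}

/-- Almost all of the mass of `ν`, weighted by its `t`-growth, is covered by finitely many cells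
of small diameter, over which the averages of `ν` belong to `𝒫_t`. -/
lemma exists_partition (ht : 0 ≤ t) {ν : ProbabilityMeasure Y} (hν : MemPt t ν) (y₀ : Y)
    {δ η : ℝ} (hδ : 0 < δ) (hη : 0 < η) :
    ∃ (n : ℕ) (c : Y → Fin (n + 1)) (ρ : Fin (n + 1) → PtSpace t Y), Measurable c ∧
      (∀ i, (ν : Measure Y) (c ⁻¹' {i}) • ((ρ i).1 : Measure Y) =
        (ν : Measure Y).restrict (c ⁻¹' {i})) ∧
      (∀ y, c y ≠ Fin.last n → ∀ᵐ z ∂((ρ (c y)).1 : Measure Y), dist y z ≤ δ) ∧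
      ∫ y in c ⁻¹' {Fin.last n}, (1 + dist y y₀ ^ t) ∂(ν : Measure Y) ≤ η := by
  classical
  let e : ℕ → Y := TopologicalSpace.denseSeq Y
  have he (y : Y) : ∃ k, dist y (e k) < δ / 2 :=
    (TopologicalSpace.denseRange_denseSeq Y).exists_dist_lt y (half_pos hδ)
  let f : Y → ℕ := fun y => Nat.find (he y)
  have hf : Measurable f := measurable_find he fun k =>
    (isOpen_lt (continuous_id.dist continuous_const) continuous_const).measurableSet
  have hfe (y : Y) : dist y (e (f y)) < δ / 2 := Nat.find_spec (he y)
  have h_int : Integrable (fun y => 1 + dist y y₀ ^ t) (ν : Measure Y) :=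
    hν.integrable ht (one_add_dist_rpow_mem_phiT ht y₀)
  have hlim : Tendsto (fun n => ∫ y in f ⁻¹' Ici n, (1 + dist y y₀ ^ t) ∂(ν : Measure Y)) atTop
      (𝓝 0) := by
    have h := tendsto_setIntegral_of_antitone (μ := (ν : Measure Y))
      (s := fun n => f ⁻¹' Ici n) (fun n => hf measurableSet_Ici)
      (fun m n hmn => preimage_mono (Ici_subset_Ici.2 hmn)) ⟨0, h_int.integrableOn⟩
    have h0 : ⋂ n, f ⁻¹' Ici n = ∅ := eq_empty_of_forall_notMem fun y hy =>
      (Nat.lt_succ_self (f y)).not_ge (mem_iInter.1 hy (f y + 1))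
    rwa [h0, setIntegral_empty] at h
  obtain ⟨n, hn⟩ := (hlim.eventually (eventually_le_nhds hη)).exists
  let c : Y → Fin (n + 1) := fun y => ⟨min (f y) n, Nat.lt_succ_of_le (min_le_right _ _)⟩
  have hc : Measurable c := (measurable_from_nat
    (f := fun k => (⟨min k n, Nat.lt_succ_of_le (min_le_right _ _)⟩ : Fin (n + 1)))).comp hf
  have hlast : c ⁻¹' {Fin.last n} = f ⁻¹' Ici n := by
    ext y
    simp [c, Fin.ext_iff]
  have hcf {y : Y} (hy : c y ≠ Fin.last n) : f y = c y := by
    have : ¬ n ≤ f y := fun h => hy (by simp [c, Fin.ext_iff, h])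
    simp [c, (not_le.1 this).le]
  choose ρ hρ hρ0 using fun i => exists_normalization
    (s := (ν : Measure Y).restrict (c ⁻¹' {i})) h_int.restrict
    (⟨⟨Measure.dirac (e i), inferInstance⟩, memPt_dirac (e i)⟩ : PtSpace t Y)
  simp only [Measure.restrict_apply_univ] at hρ hρ0
  refine ⟨n, c, ρ, hc, hρ, fun y hy => ?_, hlast ▸ hn⟩
  have hdist {z : Y} (hz : c z = c y) : dist y z ≤ δ := by
    have h1 := hfe y
    have h2 := hfe z
    rw [hcf hy] at h1
    rw [hcf (hz ▸ hy), hz] at h2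
    linarith [dist_triangle_right y z (e (c y))]
  by_cases h0 : (ν : Measure Y) (c ⁻¹' {c y}) = 0
  · rw [hρ0 _ h0]
    change ∀ᵐ z ∂Measure.dirac (e (c y)), dist y z ≤ δ
    rw [ae_dirac_iff (p := fun z => dist y z ≤ δ)
      (isClosed_le (continuous_const.dist continuous_id) continuous_const).measurableSet]
    have h1 := hfe y
    rw [hcf hy] at h1
    linarith
  · rw [← Measure.ae_ennreal_smul_measure_iff h0, hρ]
    filter_upwards [ae_restrict_mem (hc (measurableSet_singleton (c y)))] with z hz
    exact hdist hz

end Partition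

section Summable

lemma exists_integrable_bound_of_summable {α : Type*} [MeasurableSpace α] {m : Measure α}
    {F : ℕ → α → ℝ} (hF : ∀ n, Integrable (F n) m) (hF0 : ∀ n x, 0 ≤ F n x)
    (hs : Summable fun n => ∫ x, F n x ∂m) :
    ∃ S : α → ℝ, Integrable S m ∧
      ∀ᵐ x ∂m, (∀ n, F n x ≤ S x) ∧ Tendsto (fun n => F n x) atTop (𝓝 0) := by
  have hmeas (n : ℕ) : AEMeasurable (fun x => ENNReal.ofReal (F n x)) m :=
    (hF n).1.aemeasurable.ennreal_ofReal
  have hfin : ∫⁻ x, ∑' n, ENNReal.ofReal (F n x) ∂m ≠ ⊤ := by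
    rw [lintegral_tsum hmeas]
    simp_rw [← fun n => ofReal_integral_eq_lintegral_ofReal (hF n) (ae_of_all _ (hF0 n))]
    rw [← ENNReal.ofReal_tsum_of_nonneg (fun n => integral_nonneg (hF0 n)) hs]
    exact ENNReal.ofReal_ne_top
  have hmeas' : AEMeasurable (fun x => ∑' n, ENNReal.ofReal (F n x)) m := AEMeasurable.tsum hmeas
  refine ⟨fun x => (∑' n, ENNReal.ofReal (F n x)).toReal,
    integrable_toReal_of_lintegral_ne_top hmeas' hfin, ?_⟩
  filter_upwards [ae_lt_top' hmeas' hfin] with x hx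
  refine ⟨fun n => (ENNReal.ofReal_le_iff_le_toReal hx.ne).1 (ENNReal.le_tsum n), ?_⟩
  have := (ENNReal.tendsto_toReal ENNReal.zero_ne_top).comp
    (ENNReal.tendsto_atTop_zero_of_tsum_ne_top hx.ne)
  simpa [Function.comp_def, ENNReal.toReal_ofReal (hF0 _ x)] using this

end Summable

section CellAverages

variable {t : ℝ} {Z ι : Type*} [MeasurableSpace Z] [MeasurableSpace ι]
  [MeasurableSingletonClass ι]

/-- The masses of the fibres of `c` under `p`. -/
def cellWeights [Fintype ι] {c : Z → ι} (hc : Measurable c) (p : ProbabilityMeasure Z) :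
    stdSimplex ℝ ι :=
  ⟨fun i => (p : Measure Z).real (c ⁻¹' {i}), fun _ => measureReal_nonneg, by
    rw [sum_measureReal_preimage_singleton Finset.univ fun i _ => hc (measurableSet_singleton i)]
    simp⟩

lemma cellWeights_apply [Fintype ι] {c : Z → ι} (hc : Measurable c)
    (p : ProbabilityMeasure Z) (i : ι) :
    cellWeights hc p i = (p : Measure Z).real (c ⁻¹' {i}) := rfl

lemma measurable_cellWeights [Fintype ι] {α : Type*} [MeasurableSpace α] {κ : Kernel α Z}
    [IsMarkovKernel κ] {c : Z → ι} (hc : Measurable c) :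
    Measurable fun x => cellWeights hc (kernelProb κ x) :=
  (measurable_pi_iff.2 fun i =>
    (κ.measurable_coe (hc (measurableSet_singleton i))).ennreal_toReal).subtype_mk

lemma integral_cellWeights [Fintype ι] {α : Type*} [MeasurableSpace α] {m : Measure α} [SFinite m]
    {n : Measure Z} [IsFiniteMeasure n] {κ : Kernel α Z} [IsMarkovKernel κ] (hκ : κ ∘ₘ m = n)
    {c : Z → ι} (hc : Measurable c) (i : ι) :
    ∫ x, cellWeights hc (kernelProb κ x) i ∂m = n.real (c ⁻¹' {i}) := by
  have hS := hc (measurableSet_singleton i)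
  have h := (integral_comp_measure hκ ((integrable_const (1 : ℝ)).indicator hS)).2.2
  simp only [integral_indicator hS, setIntegral_one_eq_measureReal] at h
  exact h

lemma integrable_comp_cell [Fintype ι] {c : Z → ι} (hc : Measurable c) (G : ι → ℝ) (m : Measure Z)
    [IsFiniteMeasure m] : Integrable (fun y => G (c y)) m :=
  (Integrable.of_finite (f := G) (μ := m.map c)).comp_measurable hc

variable [MetricSpace Z]

/-- The contribution of the set `S` to the growth of `p` and of `p` averaged over `S`. -/
def cellRemainder (t : ℝ) (z₀ : Z) (S : Set Z) (r p : Measure Z) : ℝ :=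
  (∫ z, (1 + dist z z₀ ^ t) ∂r) * p.real S + ∫ z in S, (1 + dist z z₀ ^ t) ∂p

lemma cellRemainder_nonneg (z₀ : Z) (S : Set Z) (r p : Measure Z) :
    0 ≤ cellRemainder t z₀ S r p := by
  have h (z : Z) : 0 ≤ 1 + dist z z₀ ^ t := zero_le_one.trans (one_le_one_add_dist_rpow z z₀)
  exact add_nonneg (mul_nonneg (integral_nonneg h) measureReal_nonneg) (integral_nonneg h)

/-- The remainder of the disintegration integrates to twice the growth of the second marginal. -/
lemma integral_cellRemainder (z₀ : Z) {α : Type*} [MeasurableSpace α]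
    {m : Measure α} [SFinite m] {n : Measure Z} [IsFiniteMeasure n] {κ : Kernel α Z}
    [IsMarkovKernel κ] (hκ : κ ∘ₘ m = n) (hn : Integrable (fun z => 1 + dist z z₀ ^ t) n)
    {S : Set Z} (hS : MeasurableSet S) {r : Measure Z} (hr : n S • r = n.restrict S) :
    Integrable (fun x => cellRemainder t z₀ S r (κ x)) m ∧
      ∫ x, cellRemainder t z₀ S r (κ x) ∂m = 2 * ∫ z in S, (1 + dist z z₀ ^ t) ∂n := by
  have h1 := (integral_comp_measure hκ ((integrable_const (1 : ℝ)).indicator hS)).2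
  have h2 := (integral_comp_measure hκ (hn.indicator hS)).2
  simp only [integral_indicator hS] at h1 h2
  simp only [integral_const, smul_eq_mul, mul_one, measureReal_restrict_apply_univ] at h1
  refine ⟨(h1.1.const_mul _).add h2.1, ?_⟩
  have h3 : ∫ z in S, (1 + dist z z₀ ^ t) ∂n =
      n.real S * ∫ z, (1 + dist z z₀ ^ t) ∂r := by
    rw [← hr, integral_smul_measure]
    rfl
  simp only [cellRemainder]
  rw [integral_add (h1.1.const_mul _) h2.1, integral_const_mul, h1.2, h2.2, h3]
  ring

variable [BorelSpace Z] [SecondCountableTopology Z]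

/-- The part over the exceptional cell is controlled by the remainder. -/
lemma abs_setIntegral_sub_le_cellRemainder (ht : 0 ≤ t) (z₀ : Z) {c : Z → ι} (hc : Measurable c)
    {p : ProbabilityMeasure Z} (hp : MemPt t p) (ρ : ι → PtSpace t Z) (i : ι) {g : Z → ℝ}
    {K : ℝ} (hK : ∀ z, |g z| ≤ K * (1 + dist z z₀ ^ t)) :
    |∫ y in c ⁻¹' {i}, (∫ z, g z ∂((ρ (c y)).1 : Measure Z)) - g y ∂(p : Measure Z)| ≤
      K * cellRemainder t z₀ (c ⁻¹' {i}) ((ρ i).1 : Measure Z) p := by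
  have hS := hc (measurableSet_singleton i)
  have hh := one_add_dist_rpow_mem_phiT ht z₀
  have hpint := hp.integrable ht hh
  simp only [← Real.norm_eq_abs] at hK ⊢
  have hρi : ‖∫ z, g z ∂((ρ i).1 : Measure Z)‖ ≤
      K * ∫ z, (1 + dist z z₀ ^ t) ∂((ρ i).1 : Measure Z) := by
    rw [← integral_const_mul]
    exact norm_integral_le_of_norm_le (((ρ i).2.integrable ht hh).const_mul K)
      (ae_of_all _ hK)
  have hbd : Integrable (fun y => K * (∫ z, (1 + dist z z₀ ^ t) ∂((ρ i).1 : Measure Z)) +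
      K * (1 + dist y z₀ ^ t)) ((p : Measure Z).restrict (c ⁻¹' {i})) :=
    (integrable_const _).add (hpint.restrict.const_mul K)
  refine (norm_integral_le_of_norm_le hbd ?_).trans_eq ?_
  · filter_upwards [ae_restrict_mem hS] with y hy
    rw [mem_preimage, mem_singleton_iff] at hy
    rw [hy]
    exact (norm_sub_le _ _).trans (add_le_add hρi (hK y))
  · rw [integral_add (integrable_const _) (hpint.restrict.const_mul K), integral_const,
      integral_const_mul, measureReal_restrict_apply_univ, cellRemainder, smul_eq_mul]
    ring

variable [Fintype ι] [Nonempty Z]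

lemma integral_mixture_cellWeights (ht : 0 ≤ t) {c : Z → ι} (hc : Measurable c)
    (p : ProbabilityMeasure Z) (ρ : ι → PtSpace t Z) {g : Z → ℝ} (hg : g ∈ PhiT t Z) :
    ∫ z, g z ∂((mixture ht (cellWeights hc p) ρ).1 : Measure Z) =
      ∫ y, ∫ z, g z ∂((ρ (c y)).1 : Measure Z) ∂(p : Measure Z) := by
  have hG : Measurable fun i => ∫ z, g z ∂((ρ i).1 : Measure Z) := measurable_of_finite _
  rw [integral_mixture ht _ _ hg,
    ← integral_map (φ := c) (f := fun i => ∫ z, g z ∂((ρ i).1 : Measure Z)) hc.aemeasurable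
      hG.aestronglyMeasurable, integral_fintype Integrable.of_finite]
  refine Finset.sum_congr rfl fun i _ => ?_
  rw [cellWeights_apply, map_measureReal_apply hc (measurableSet_singleton i), smul_eq_mul]

end CellAverages

section Approximation

variable {t : ℝ} {Z : Type*} [MetricSpace Z] [MeasurableSpace Z]

lemma abs_integral_le_of_ae_dist_le (ht : 0 ≤ t) (z₀ : Z) {r : ProbabilityMeasure Z} {y : Z}
    {D : ℝ} (hD : D ≤ 1) (hr : ∀ᵐ z ∂(r : Measure Z), dist y z ≤ D) {g : Z → ℝ} {K : ℝ}
    (hK0 : 0 ≤ K) (hK : ∀ z, |g z| ≤ K * (1 + dist z z₀ ^ t)) :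
    |∫ z, g z ∂(r : Measure Z)| ≤ K * ((1 + 2 ^ t * 1 ^ t + 2 ^ t) * (1 + dist y z₀ ^ t)) := by
  have h : ∀ᵐ z ∂(r : Measure Z), ‖g z‖ ≤
      K * ((1 + 2 ^ t * 1 ^ t + 2 ^ t) * (1 + dist y z₀ ^ t)) := by
    filter_upwards [hr] with z hz
    exact (hK z).trans (mul_le_mul_of_nonneg_left (one_add_dist_rpow_le ht (hz.trans hD)) hK0)
  simpa using norm_integral_le_of_norm_le_const h

variable [BorelSpace Z] [SecondCountableTopology Z] [Nonempty Z]

lemma integral_mixture_le (ht : 0 ≤ t) (z₀ : Z) {n : ℕ} {c : Z → Fin (n + 1)}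
    (hc : Measurable c) {p : ProbabilityMeasure Z} (hp : MemPt t p) {ρ : Fin (n + 1) → PtSpace t Z}
    {D : ℝ} (hD : D ≤ 1)
    (hdiam : ∀ y, c y ≠ Fin.last n → ∀ᵐ z ∂((ρ (c y)).1 : Measure Z), dist y z ≤ D) :
    ∫ z, (1 + dist z z₀ ^ t) ∂((mixture ht (cellWeights hc p) ρ).1 : Measure Z) ≤
      (1 + 2 ^ t * 1 ^ t + 2 ^ t) * ∫ z, (1 + dist z z₀ ^ t) ∂(p : Measure Z) +
        cellRemainder t z₀ (c ⁻¹' {Fin.last n}) ((ρ (Fin.last n)).1 : Measure Z) p := by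
  have hS := hc (measurableSet_singleton (Fin.last n))
  have hh := one_add_dist_rpow_mem_phiT ht z₀
  have h0 (z : Z) : 0 ≤ 1 + dist z z₀ ^ t := zero_le_one.trans (one_le_one_add_dist_rpow z z₀)
  have hpint := hp.integrable ht hh
  set L : ℝ := 1 + 2 ^ t * 1 ^ t + 2 ^ t with hL
  have hL0 : 0 ≤ L := by positivity
  have hG := integrable_comp_cell hc (fun i => ∫ z, (1 + dist z z₀ ^ t) ∂((ρ i).1 : Measure Z))
    (p : Measure Z)
  rw [integral_mixture_cellWeights ht hc p ρ hh, ← integral_add_compl hS hG, add_comm]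
  refine add_le_add ?_ ?_
  · calc _ ≤ ∫ y in (c ⁻¹' {Fin.last n})ᶜ, L * (1 + dist y z₀ ^ t) ∂(p : Measure Z) := by
          refine setIntegral_mono_on hG.integrableOn (hpint.const_mul L).integrableOn hS.compl
            fun y hy => ?_
          refine (le_abs_self _).trans ?_
          have := abs_integral_le_of_ae_dist_le ht z₀ hD (hdiam y hy) zero_le_one
            (g := fun z => 1 + dist z z₀ ^ t) fun z => by rw [abs_of_nonneg (h0 z), one_mul]
          rwa [one_mul] at this
      _ ≤ ∫ y, L * (1 + dist y z₀ ^ t) ∂(p : Measure Z) :=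
          setIntegral_le_integral (hpint.const_mul L)
            (ae_of_all _ fun y => mul_nonneg hL0 (h0 y))
      _ = _ := integral_const_mul _ _
  · have hcongr : ∫ y in c ⁻¹' {Fin.last n}, (∫ z, (1 + dist z z₀ ^ t) ∂((ρ (c y)).1 : Measure Z))
        ∂(p : Measure Z) = ∫ _ in c ⁻¹' {Fin.last n},
          (∫ z, (1 + dist z z₀ ^ t) ∂((ρ (Fin.last n)).1 : Measure Z)) ∂(p : Measure Z) :=
      setIntegral_congr_fun hS fun y hy => by rw [show c y = Fin.last n from hy]
    rw [hcongr, integral_const, measureReal_restrict_apply_univ, smul_eq_mul, mul_comm,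
      cellRemainder]
    exact le_add_of_nonneg_right (integral_nonneg h0)

/-- Averaging over finer and finer cells approximates `p` in `𝒫_t` as soon as the remainders
vanish. -/
lemma tendsto_mixture_cellWeights (ht : 0 ≤ t) (z₀ : Z) {n : ℕ → ℕ}
    {c : ∀ m, Z → Fin (n m + 1)} (hc : ∀ m, Measurable (c m))
    {ρ : ∀ m, Fin (n m + 1) → PtSpace t Z} {δ : ℕ → ℝ} (hδ : Tendsto δ atTop (𝓝 0))
    (hδ1 : ∀ m, δ m ≤ 1)
    (hdiam : ∀ m y, c m y ≠ Fin.last (n m) →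
      ∀ᵐ z ∂((ρ m (c m y)).1 : Measure Z), dist y z ≤ δ m)
    {p : ProbabilityMeasure Z} (hp : MemPt t p)
    (hrem : Tendsto (fun m => cellRemainder t z₀ (c m ⁻¹' {Fin.last (n m)})
      ((ρ m (Fin.last (n m))).1 : Measure Z) p) atTop (𝓝 0)) :
    Tendsto (fun m => mixture ht (cellWeights (hc m) p) (ρ m)) atTop (𝓝 ⟨p, hp⟩) := by
  refine tendsto_ptSpace_iff.2 fun g hg => ?_
  obtain ⟨K, hK0, hK⟩ := exists_abs_le_of_mem_phiT ht z₀ hg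
  have hS (m : ℕ) := hc m (measurableSet_singleton (Fin.last (n m)))
  have hgp := hp.integrable ht hg
  have hhp := hp.integrable ht (one_add_dist_rpow_mem_phiT ht z₀)
  set L : ℝ := 1 + 2 ^ t * 1 ^ t + 2 ^ t with hL
  let G : ℕ → Z → ℝ := fun m y => ∫ z, g z ∂((ρ m (c m y)).1 : Measure Z)
  have hG (m : ℕ) : Integrable (G m) (p : Measure Z) :=
    integrable_comp_cell (hc m) (fun i => ∫ z, g z ∂((ρ m i).1 : Measure Z)) _
  have hmain : Tendsto (fun m => ∫ y, ((c m ⁻¹' {Fin.last (n m)})ᶜ).indicator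
      (fun y => G m y - g y) y ∂(p : Measure Z)) atTop (𝓝 (∫ _, (0 : ℝ) ∂(p : Measure Z))) := by
    refine tendsto_integral_of_dominated_convergence
      (fun y => K * (L * (1 + dist y z₀ ^ t)) + K * (1 + dist y z₀ ^ t))
      (fun m => (((hG m).sub hgp).indicator (hS m).compl).1)
      (((hhp.const_mul L).const_mul K).add (hhp.const_mul K))
      (fun m => ae_of_all _ fun y => ?_) (ae_of_all _ fun y => ?_)
    · have h0 := zero_le_one.trans (one_le_one_add_dist_rpow (t := t) y z₀)
      by_cases hy : c m y = Fin.last (n m)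
      · rw [indicator_of_notMem (by simpa using hy), norm_zero]
        positivity
      · rw [indicator_of_mem (by simpa using hy)]
        exact (norm_sub_le _ _).trans (add_le_add
          (abs_integral_le_of_ae_dist_le ht z₀ (hδ1 m) (hdiam m y hy) hK0 hK) (hK y))
    · refine Metric.tendsto_nhds.2 fun ε hε => ?_
      obtain ⟨η, hη, hgη⟩ := Metric.continuousAt_iff.1 hg.1.continuousAt (ε / 2) (half_pos hε)
      filter_upwards [hδ.eventually (eventually_lt_nhds hη)] with m hm
      rw [dist_zero_right]
      by_cases hy : c m y = Fin.last (n m)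
      · rwa [indicator_of_notMem (by simpa using hy), norm_zero]
      · rw [indicator_of_mem (by simpa using hy)]
        have hsub : G m y - g y = ∫ z, (g z - g y) ∂((ρ m (c m y)).1 : Measure Z) := by
          rw [integral_sub ((ρ m (c m y)).2.integrable ht hg) (integrable_const _)]
          simp [G]
        have hae : ∀ᵐ z ∂((ρ m (c m y)).1 : Measure Z), ‖g z - g y‖ ≤ ε / 2 := by
          filter_upwards [hdiam m y hy] with z hz
          exact (hgη (by rw [dist_comm]; exact hz.trans_lt hm)).le
        rw [hsub]
        refine (norm_integral_le_of_norm_le_const hae).trans_lt ?_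
        simpa using half_lt_self hε
  have hlast : Tendsto (fun m => ∫ y in c m ⁻¹' {Fin.last (n m)}, (G m y - g y)
      ∂(p : Measure Z)) atTop (𝓝 0) := by
    refine squeeze_zero_norm (fun m => abs_setIntegral_sub_le_cellRemainder ht z₀ (hc m) hp (ρ m)
      (Fin.last (n m)) hK) ?_
    simpa using hrem.const_mul K
  have hsum := (hmain.add hlast).add_const (∫ z, g z ∂(p : Measure Z))
  rw [integral_zero, zero_add, zero_add] at hsum
  refine hsum.congr fun m => ?_
  rw [integral_mixture_cellWeights ht (hc m) p (ρ m) hg, integral_indicator (hS m).compl,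
    add_comm (∫ y in _, _ ∂_), integral_add_compl (f := fun y => G m y - g y) (hS m)
      ((hG m).sub hgp), integral_sub (hG m) hgp, sub_add_cancel]

/-- Every kernel with second marginal `ν` is, in cost, the limit of finite-rank kernels with second
marginal `ν`. -/
theorem exists_tendsto_integral_mixture (ht : 0 ≤ t) {C : X → ProbabilityMeasure Y → ℝ}
    (hcont : Continuous fun q : X × PtSpace t Y => C q.1 q.2.1)
    {R : ℝ} (hR : 0 ≤ R) {x₀ : X} {y₀ : Y}
    (hbound : ∀ x p, MemPt t p →
      |C x p| ≤ R * ((1 + dist x x₀ ^ t) + ∫ y, (1 + dist y y₀ ^ t) ∂(p : Measure Y)))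
    {μ : ProbabilityMeasure X} {ν : ProbabilityMeasure Y} (hμ : MemPt t μ) (hν : MemPt t ν)
    {κ : Kernel X Y} [IsMarkovKernel κ] (hκ : κ ∘ₘ (μ : Measure X) = ν) :
    Integrable (fun x => C x (kernelProb κ x)) (μ : Measure X) ∧
    ∃ (n : ℕ → ℕ) (c : ∀ m, Y → Fin (n m + 1)) (hc : ∀ m, Measurable (c m))
      (ρ : ∀ m, Fin (n m + 1) → PtSpace t Y),
      (∀ m i, (ν : Measure Y) (c m ⁻¹' {i}) • ((ρ m i).1 : Measure Y) =
        (ν : Measure Y).restrict (c m ⁻¹' {i})) ∧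
      Tendsto (fun m => ∫ x, C x (mixture ht (cellWeights (hc m) (kernelProb κ x)) (ρ m)).1
        ∂(μ : Measure X)) atTop (𝓝 (∫ x, C x (kernelProb κ x) ∂(μ : Measure X))) := by
  let δ : ℕ → ℝ := fun m => 1 / (m + 1)
  have hδ : Tendsto δ atTop (𝓝 0) := tendsto_one_div_add_atTop_nhds_zero_nat
  have hδ0 (m : ℕ) : 0 < δ m := Nat.one_div_pos_of_nat
  have hδ1 (m : ℕ) : δ m ≤ 1 := by
    simpa [δ] using Nat.one_div_le_one_div (α := ℝ) (Nat.zero_le m)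
  choose n c ρ hc hρ hdiam hη using fun m : ℕ =>
    exists_partition ht hν y₀ (hδ0 m) (η := (1 / 2) ^ m) (by positivity)
  have hhν := hν.integrable ht (one_add_dist_rpow_mem_phiT ht y₀)
  have hhμ := hμ.integrable ht (one_add_dist_rpow_mem_phiT ht x₀)
  have hhκ := integral_comp_measure hκ hhν
  have hmem : ∀ᵐ x ∂(μ : Measure X), MemPt t (kernelProb κ x) := by
    filter_upwards [hhκ.1] with x hx
    exact memPt_of_integrable (z₀ := y₀) hx
  let F : ℕ → X → ℝ := fun m x => cellRemainder t y₀ (c m ⁻¹' {Fin.last (n m)})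
    ((ρ m (Fin.last (n m))).1 : Measure Y) (κ x)
  have hF (m : ℕ) := integral_cellRemainder y₀ hκ hhν
    (hc m (measurableSet_singleton (Fin.last (n m)))) (hρ m _)
  have hF0 (m : ℕ) (x : X) : 0 ≤ F m x := cellRemainder_nonneg _ _ _ _
  obtain ⟨S, hS, hFS⟩ := exists_integrable_bound_of_summable (m := (μ : Measure X)) (F := F)
    (fun m => (hF m).1) hF0 <| by
      refine Summable.of_nonneg_of_le (fun m => integral_nonneg (hF0 m)) (fun m => ?_)
        (summable_geometric_two.mul_left 2)
      exact (hF m).2.trans_le (mul_le_mul_of_nonneg_left (hη m) zero_le_two)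
  set L : ℝ := 1 + 2 ^ t * 1 ^ t + 2 ^ t with hL
  have hmeas (m : ℕ) : Measurable fun x =>
      C x (mixture ht (cellWeights (hc m) (kernelProb κ x)) (ρ m)).1 := by
    have hG : Continuous fun q : X × stdSimplex ℝ (Fin (n m + 1)) =>
        C q.1 (mixture ht q.2 (ρ m)).1 :=
      hcont.comp (continuous_fst.prodMk
        ((continuous_mixture ht).comp (continuous_snd.prodMk continuous_const)))
    exact hG.measurable.comp (measurable_id.prodMk (measurable_cellWeights (hc m)))
  have hlim : ∀ᵐ x ∂(μ : Measure X), Tendsto (fun m =>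
      C x (mixture ht (cellWeights (hc m) (kernelProb κ x)) (ρ m)).1) atTop
      (𝓝 (C x (kernelProb κ x))) := by
    filter_upwards [hmem, hFS] with x hx hxF
    have h := tendsto_mixture_cellWeights ht y₀ hc hδ hδ1 hdiam hx hxF.2
    exact (hcont.tendsto (x, ⟨kernelProb κ x, hx⟩)).comp (tendsto_const_nhds.prodMk_nhds h)
  have hsm : AEStronglyMeasurable (fun x => C x (kernelProb κ x)) (μ : Measure X) :=
    aestronglyMeasurable_of_tendsto_ae atTop (fun m => (hmeas m).aestronglyMeasurable) hlim
  refine ⟨((hhμ.add hhκ.2.1).const_mul R).mono' hsm ?_, n, c, hc, ρ, hρ, ?_⟩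
  · filter_upwards [hmem] with x hx
    exact hbound x _ hx
  · refine tendsto_integral_of_dominated_convergence
      (fun x => R * ((1 + dist x x₀ ^ t) + (L * ∫ y, (1 + dist y y₀ ^ t) ∂κ x + S x)))
      (fun m => (hmeas m).aestronglyMeasurable)
      ((hhμ.add ((hhκ.2.1.const_mul L).add hS)).const_mul R) (fun m => ?_) hlim
    filter_upwards [hmem, hFS] with x hx hxF
    refine (hbound x _ (mixture ht _ (ρ m)).2).trans (mul_le_mul_of_nonneg_left ?_ hR)
    refine add_le_add le_rfl ((integral_mixture_le ht y₀ (hc m) hx (hδ1 m) (hdiam m)).trans ?_)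
    exact add_le_add le_rfl (hxF.1 m)

end Approximation

section Disintegration

lemma condKernel_comp_fst {α Ω : Type*} [MeasurableSpace α] [MeasurableSpace Ω]
    [StandardBorelSpace Ω] [Nonempty Ω] (ρ : Measure (α × Ω)) [IsFiniteMeasure ρ] :
    ρ.condKernel ∘ₘ ρ.fst = ρ.snd := by
  rw [← Measure.snd_compProd, Measure.disintegrate]

end Disintegration

/-- For a continuous cost with `t`-growth which is convex in the measure variable, every
`C`-monotone coupling between measures in `𝒫_t` is optimal for the weak transport problem. -/
theorem cMonotone_coupling_is_optimal
    (t : ℝ) (ht : 1 ≤ t) (C : X → ProbabilityMeasure Y → ℝ)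
    (hcont : Continuous fun q : X × PtSpace t Y => C q.1 q.2.1)
    (hbound : ∃ (R : ℝ) (x₀ : X) (y₀ : Y), ∀ (x : X) (p : ProbabilityMeasure Y), MemPt t p →
      |C x p| ≤ R * (dist x x₀ ^ t + ∫ y, dist y y₀ ^ t ∂(p : Measure Y)))
    (hconv : ∀ x : X, ∀ p q r : ProbabilityMeasure Y, MemPt t p → MemPt t q →
      ∀ a b : ℝ≥0, a + b = 1 →
      (r : Measure Y) = (a : ℝ≥0∞) • (p : Measure Y) + (b : ℝ≥0∞) • (q : Measure Y) →
      C x r ≤ (a : ℝ) * C x p + (b : ℝ) * C x q)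
    (μ : ProbabilityMeasure X) (ν : ProbabilityMeasure Y)
    (hμ : MemPt t μ) (hν : MemPt t ν)
    (π : ProbabilityMeasure (X × Y)) (hπ : IsCoupling μ ν π)
    (hmono : ∃ Γ : Set (X × ProbabilityMeasure Y),
      (∀ xp ∈ Γ, MemPt t xp.2) ∧ CMonotoneR t C Γ ∧
        ∀ᵐ x ∂(μ : Measure X), (x, disint π x) ∈ Γ) :
    ∀ π' : ProbabilityMeasure (X × Y), IsCoupling μ ν π' →
      weakCostR C μ π ≤ weakCostR C μ π' := by
  intro π' hπ'
  obtain ⟨R, x₀, y₀, hR⟩ := hbound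
  obtain ⟨Γ, hΓp, hΓ, hπΓ⟩ := hmono
  have ht0 : 0 ≤ t := zero_le_one.trans ht
  have hbound' : ∀ x p, MemPt t p →
      |C x p| ≤ |R| * ((1 + dist x x₀ ^ t) + ∫ y, (1 + dist y y₀ ^ t) ∂(p : Measure Y)) := by
    intro x p hp
    have hd : Integrable (fun y => dist y y₀ ^ t) (p : Measure Y) := by
      simpa [Pi.sub_def] using
        (hp.integrable ht0 (one_add_dist_rpow_mem_phiT ht0 y₀)).sub (integrable_const (1 : ℝ))
    have h0 : 0 ≤ dist x x₀ ^ t + ∫ y, dist y y₀ ^ t ∂(p : Measure Y) :=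
      add_nonneg (by positivity) (integral_nonneg fun y => by positivity)
    rw [integral_add (integrable_const _) hd, integral_const, probReal_univ, one_smul]
    refine (hR x p hp).trans ((mul_le_mul_of_nonneg_right (le_abs_self R) h0).trans ?_)
    exact mul_le_mul_of_nonneg_left (by linarith) (abs_nonneg R)
  have hcomp (σ : ProbabilityMeasure (X × Y)) (hσ : IsCoupling μ ν σ) :
      (σ : Measure (X × Y)).condKernel ∘ₘ (μ : Measure X) = ν := by
    rw [← hσ.1, ← hσ.2]
    exact condKernel_comp_fst _
  have h_int := (exists_tendsto_integral_mixture ht0 hcont (abs_nonneg R) hbound' hμ hν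
    (hcomp π hπ)).1
  obtain ⟨-, n, c, hc, ρ, hρ, hlim⟩ := exists_tendsto_integral_mixture ht0 hcont (abs_nonneg R)
    hbound' hμ hν (hcomp π' hπ')
  refine ge_of_tendsto' hlim fun m => ?_
  exact integral_le_integral_mixture ht0 hcont (abs_nonneg R) hbound' hμ hν (hcomp π hπ)
    hΓp hΓ hπΓ h_int (hc m) (hρ m) (measurable_cellWeights (hc m))
    (integral_cellWeights (hcomp π' hπ') (hc m))

end
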